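/- Let E and H be real inner product spaces. Let μ, λ, K', D' be strictly positive reals, α, β arbitrary reals, and c₁, c₂, b₀ reals with b₀ ≥ 0, c₁ ≥ b₀ and c₂ ≥ b₀. For e ∈ E and w, q, s ∈ H define M(e, w, q, s) := 2μ‖e‖² + (1/λ)‖w‖² + (c₁ + α²/λ)‖q‖² + (c₂ + β²/λ)‖s‖² − (2/λ)⟪w, α•q + β•s⟫ + 2(αβ/λ − b₀)⟪q, s⟫ + K'‖q‖² + D'‖s‖². Then M(e, w, q, s) ≥ 0 for all e, w, q, s, and M(e, w, q, s) = 0 implies e = 0, w = 0, q = 0 and s = 0. -/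

import Mathlib

open scoped RealInnerProductSpace

/-- Hilbert-space abstraction of Lemma 2.1: the quadratic form of the system
matrix is nonnegative and vanishes only at zero. -/
theorem stmt2 {E H : Type*} [NormedAddCommGroup E] [InnerProductSpace ℝ E]
    [NormedAddCommGroup H] [InnerProductSpace ℝ H]
    (μ lam K' D' : ℝ) (hμ : 0 < μ) (hlam : 0 < lam) (hK : 0 < K') (hD : 0 < D')
    (α β c₁ c₂ b₀ : ℝ) (hb₀ : 0 ≤ b₀) (hc₁ : b₀ ≤ c₁) (hc₂ : b₀ ≤ c₂)
    (M : E → H → H → H → ℝ)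
    (hM : ∀ e w q s, M e w q s =
      2*μ*‖e‖^2 + (1/lam)*‖w‖^2 + (c₁ + α^2/lam)*‖q‖^2 + (c₂ + β^2/lam)*‖s‖^2
        - (2/lam)*⟪w, α • q + β • s⟫ + 2*(α*β/lam - b₀)*⟪q, s⟫
        + K'*‖q‖^2 + D'*‖s‖^2) :
    ∀ (e : E) (w q s : H),
      0 ≤ M e w q s ∧ (M e w q s = 0 → e = 0 ∧ w = 0 ∧ q = 0 ∧ s = 0) := by
  intro e w q s
  have hsq : M e w q s = 2*μ*‖e‖^2 + (1/lam)*‖w - (α • q + β • s)‖^2 + b₀*‖q - s‖^2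
      + (c₁ - b₀ + K')*‖q‖^2 + (c₂ - b₀ + D')*‖s‖^2 := by
    rw [hM, norm_sub_sq_real w, norm_sub_sq_real q s, norm_add_sq_real]
    simp only [norm_smul, mul_pow, Real.norm_eq_abs, sq_abs, real_inner_smul_left,
      real_inner_smul_right]
    ring
  have hE : 0 ≤ 2*μ*‖e‖^2 := by positivity
  have hW : 0 ≤ (1/lam)*‖w - (α • q + β • s)‖^2 := by positivity
  have hB : 0 ≤ b₀*‖q - s‖^2 := by positivity
  have hcK : 0 < c₁ - b₀ + K' := by linarith
  have hcD : 0 < c₂ - b₀ + D' := by linarith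
  have hQ : 0 ≤ (c₁ - b₀ + K')*‖q‖^2 := by positivity
  have hS : 0 ≤ (c₂ - b₀ + D')*‖s‖^2 := by positivity
  rw [hsq]
  refine ⟨by positivity, fun h => ?_⟩
  have he : 2*μ*‖e‖^2 = 0 := by linarith
  have hw : (1/lam)*‖w - (α • q + β • s)‖^2 = 0 := by linarith
  have hq : (c₁ - b₀ + K')*‖q‖^2 = 0 := by linarith
  have hs : (c₂ - b₀ + D')*‖s‖^2 = 0 := by linarith
  have hq0 : q = 0 := by simpa [hcK.ne'] using hq
  have hs0 : s = 0 := by simpa [hcD.ne'] using hs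
  subst hq0 hs0
  exact ⟨by simpa [hμ.ne'] using he, by simpa [hlam.ne'] using hw, rfl, rfl⟩
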